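/- Fix a length-T economy E^T and suppose the CVR-dynamic-stability correspondence D̂S_{T−1} for length-(T−1) economies is nonempty-valued. Define φ_0(∅,k) = M_T(∅,k) for each k ∈ A_1∪B_1, and for n ≥ 1 let φ_n(∅,k) = {m̄ ∈ M_T(∅,k) : m̄_1 is stable among those who match in period 1 relative to φ_{n−1}(∅,·), and the restriction of (m̄_t)_{t=2}^T to E_2^T(m̄_1) lies in D̂S_{T−1}(E_2^T(m̄_1))}. Then for every n ≥ 0 and every k ∈ A_1∪B_1, φ_{n+1}(∅,k) ⊆ φ_n(∅,k). -/

import Mathlib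

/-!
A framework for two-sided, one-to-one, irreversible dynamic matching markets
with conjectures, following Doval's "A framework for (dynamic) stability".

Periods are indexed `0, …, T-1` (the paper's periods `1, …, T`).
-/

namespace DynMatch

open Classical

noncomputable section

/-- A length-`T` two-sided dynamic economy: the arrivals on each side in each period. -/
structure Economy (A B : Type) where
  T : ℕ
  arrA : ℕ → Finset A
  arrB : ℕ → Finset B

/-- Validity of an economy: positive length, pairwise disjoint arrivals, and
no arrivals outside the horizon. -/
def Economy.Valid {A B : Type} (E : Economy A B) : Prop :=
  0 < E.T ∧
  (∀ s t, s ≠ t → Disjoint (E.arrA s) (E.arrA t)) ∧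
  (∀ s t, s ≠ t → Disjoint (E.arrB s) (E.arrB t)) ∧
  (∀ s, E.T ≤ s → E.arrA s = ∅) ∧ (∀ s, E.T ≤ s → E.arrB s = ∅)

/-- A raw dynamic matching: in every period, a partial pairing between the two sides
(`none` means unmatched, i.e. matched to oneself). -/
structure PreMatching (A B : Type) where
  mA : ℕ → A → Option B
  mB : ℕ → B → Option A

variable {A B : Type} [DecidableEq A] [DecidableEq B]

/-- Side-`A` agents having arrived up to (and including) period `t`. -/
def arrAUpTo (E : Economy A B) (t : ℕ) : Finset A := (Finset.range (t+1)).biUnion E.arrA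

/-- Side-`B` agents having arrived up to (and including) period `t`. -/
def arrBUpTo (E : Economy A B) (t : ℕ) : Finset B := (Finset.range (t+1)).biUnion E.arrB

/-- `m` is an irreversible dynamic matching for the economy `E`: in every period it is
an involutive pairing between arrived agents of the two sides, and once matched a
pair stays matched. -/
def IsMatching (E : Economy A B) (m : PreMatching A B) : Prop :=
  (∀ t a b, t < E.T → (m.mA t a = some b ↔ m.mB t b = some a)) ∧
  (∀ t a, t < E.T → m.mA t a ≠ none → a ∈ arrAUpTo E t) ∧
  (∀ t a b, t < E.T → m.mA t a = some b → b ∈ arrBUpTo E t) ∧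
  (∀ t s a, t ≤ s → s < E.T → m.mA t a ≠ none → m.mA s a = m.mA t a) ∧
  (∀ t s b, t ≤ s → s < E.T → m.mB t b ≠ none → m.mB s b = m.mB t b)

/-- The everywhere-unmatched prematching. -/
def emptyM : PreMatching A B := ⟨fun _ _ => none, fun _ _ => none⟩

/-- An agent of the economy: a side-`A` or a side-`B` agent. -/
abbrev Agent (A B : Type) := A ⊕ B

/-- `𝒜_t(m^{t-1})`: side-`A` agents available to match in period `t` given history `m`. -/
def availA (E : Economy A B) (m : PreMatching A B) (t : ℕ) : Finset A :=
  (arrAUpTo E t).filter fun a => ∀ s, s < t → m.mA s a = none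

/-- `ℬ_t(m^{t-1})`: side-`B` agents available to match in period `t` given history `m`. -/
def availB (E : Economy A B) (m : PreMatching A B) (t : ℕ) : Finset B :=
  (arrBUpTo E t).filter fun b => ∀ s, s < t → m.mB s b = none

/-- `k ∈ 𝒜_t(m^{t-1}) ∪ ℬ_t(m^{t-1})`. -/
def isAvail (E : Economy A B) (m : PreMatching A B) (t : ℕ) : Agent A B → Prop
  | Sum.inl a => a ∈ availA E m t
  | Sum.inr b => b ∈ availB E m t

/-- `k ∈ A_1 ∪ B_1`: `k` is a first-period arrival. -/
def inPeriodOne (E : Economy A B) : Agent A B → Prop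
  | Sum.inl a => a ∈ E.arrA 0
  | Sum.inr b => b ∈ E.arrB 0

/-- `m_t(k) = k`: agent `k` is unmatched in period `t` under `m`. -/
def unmatchedAt (m : PreMatching A B) (t : ℕ) : Agent A B → Prop
  | Sum.inl a => m.mA t a = none
  | Sum.inr b => m.mB t b = none

/-- `m` and `m'` agree in all periods `s < t` (i.e. they share the history `m^{t-1}`). -/
def agreeUpTo (m m' : PreMatching A B) (t : ℕ) : Prop :=
  ∀ s, s < t → (∀ a, m.mA s a = m'.mA s a) ∧ (∀ b, m.mB s b = m'.mB s b)

/-- Agent `k` is unmatched through period `t` (all periods `s ≤ t`) under `m`. -/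
def unmatchedThrough (m : PreMatching A B) (t : ℕ) : Agent A B → Prop
  | Sum.inl a => ∀ s, s ≤ t → m.mA s a = none
  | Sum.inr b => ∀ s, s ≤ t → m.mB s b = none

/-- `M_T(m^{t-1})`: matchings of `E` agreeing with `m` through period `t-1`. -/
def MSetH (E : Economy A B) (m : PreMatching A B) (t : ℕ) : Set (PreMatching A B) :=
  {m' | IsMatching E m' ∧ agreeUpTo m m' t}

/-- `M_T(m^{t-1}, k)`: matchings of `E` agreeing with `m` through period `t-1` and
leaving `k` unmatched through period `t`. -/
def MSet (E : Economy A B) (m : PreMatching A B) (t : ℕ) (k : Agent A B) :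
    Set (PreMatching A B) :=
  {m' | IsMatching E m' ∧ agreeUpTo m m' t ∧ unmatchedThrough m' t k}

/-- Preferences: Bernoulli utilities on both sides and discount factors.
(The payoff of remaining single is normalized to `0`.) -/
structure Pref (A B : Type) where
  u : A → B → ℝ
  v : A → B → ℝ
  dA : A → ℝ
  dB : B → ℝ

/-- Discount factors lie in `[0,1]`. -/
def Pref.Valid (P : Pref A B) : Prop :=
  (∀ a, 0 ≤ P.dA a ∧ P.dA a ≤ 1) ∧ (∀ b, 0 ≤ P.dB b ∧ P.dB b ≤ 1)

/-- `t_m(a)`: the first period `s ≥ t` at which `a` is matched under `m` (`T` if never). -/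
def matchTimeA (E : Economy A B) (m : PreMatching A B) (t : ℕ) (a : A) : ℕ :=
  min (sInf {s | t ≤ s ∧ m.mA s a ≠ none}) E.T

/-- `t_m(b)`: the first period `s ≥ t` at which `b` is matched under `m` (`T` if never). -/
def matchTimeB (E : Economy A B) (m : PreMatching A B) (t : ℕ) (b : B) : ℕ :=
  min (sInf {s | t ≤ s ∧ m.mB s b ≠ none}) E.T

/-- `U_t(a,m) = δ_a^{t_m(a)-t}·u(a, m_T(a))` (and `0` if `a` ends up unmatched). -/
def Upay (P : Pref A B) (E : Economy A B) (m : PreMatching A B) (t : ℕ) (a : A) : ℝ :=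
  match m.mA (E.T - 1) a with
  | none => 0
  | some b => P.dA a ^ (matchTimeA E m t a - t) * P.u a b

/-- `V_t(b,m) = δ_b^{t_m(b)-t}·v(m_T(b), b)` (and `0` if `b` ends up unmatched). -/
def Vpay (P : Pref A B) (E : Economy A B) (m : PreMatching A B) (t : ℕ) (b : B) : ℝ :=
  match m.mB (E.T - 1) b with
  | none => 0
  | some a => P.dB b ^ (matchTimeB E m t b - t) * P.v a b

/-- A family of conjectures `Φ`: for every period `t`, history `m^{t-1}` and agent `k`,
a set `φ_t(m^{t-1},k)` of matchings `k` considers possible upon remaining unmatched. -/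
abbrev ConjFam (A B : Type) := ℕ → PreMatching A B → Agent A B → Set (PreMatching A B)

/-- Validity of a family of conjectures for `E`: conjectures are (nonempty) subsets of
`M_T(m^{t-1},k)` and depend on the matching only through the history `m^{t-1}`. -/
def ConjFam.Valid (E : Economy A B) (φ : ConjFam A B) : Prop :=
  (∀ t m k, φ t m k ⊆ MSet E m t k) ∧
  (∀ t m m' k, agreeUpTo m m' t → φ t m k = φ t m' k) ∧
  (∀ t m k, t < E.T → IsMatching E m → isAvail E m t k → (φ t m k).Nonempty)

/-- `m` is a `Φ`-solution for `E` (Definition 3): in every period, every available agent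
weakly prefers `m` to some conjectured matching, and no available pair blocks. -/
def IsSolution (P : Pref A B) (E : Economy A B) (φ : ConjFam A B)
    (m : PreMatching A B) : Prop :=
  IsMatching E m ∧
  ∀ t, t < E.T →
    ((∀ a ∈ availA E m t, ∃ m' ∈ φ t m (Sum.inl a), Upay P E m' t a ≤ Upay P E m t a) ∧
     (∀ b ∈ availB E m t, ∃ m' ∈ φ t m (Sum.inr b), Vpay P E m' t b ≤ Vpay P E m t b) ∧
     (∀ a ∈ availA E m t, ∀ b ∈ availB E m t,
        ¬(P.u a b > Upay P E m t a ∧ P.v a b > Vpay P E m t b)))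

/-- `Σ^Φ_T(E)`: the set of `Φ`-solutions of `E`. -/
def SolSet (P : Pref A B) (E : Economy A B) (φ : ConjFam A B) : Set (PreMatching A B) :=
  {m | IsSolution P E φ m}

/-- The static (Gale–Shapley) notion of stability, for length-1 economies:
individual rationality plus absence of blocking pairs. -/
def Stable1 (P : Pref A B) (E : Economy A B) (m : PreMatching A B) : Prop :=
  IsMatching E m ∧
  (∀ a b, m.mA (E.T - 1) a = some b → 0 ≤ P.u a b) ∧
  (∀ b a, m.mB (E.T - 1) b = some a → 0 ≤ P.v a b) ∧
  (∀ a ∈ E.arrA 0, ∀ b ∈ E.arrB 0,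
     ¬(P.u a b > Upay P E m 0 a ∧ P.v a b > Vpay P E m 0 b))

/-- The worst (minimal) period-`t` payoff of `a` over the set `C (inl a)` of matchings. -/
def wA (P : Pref A B) (E : Economy A B) (t : ℕ)
    (C : Agent A B → Set (PreMatching A B)) (a : A) : ℝ :=
  sInf ((fun m' => Upay P E m' t a) '' C (Sum.inl a))

/-- The worst (minimal) period-`t` payoff of `b` over the set `C (inr b)` of matchings. -/
def wB (P : Pref A B) (E : Economy A B) (t : ℕ)
    (C : Agent A B → Set (PreMatching A B)) (b : B) : ℝ :=
  sInf ((fun m' => Vpay P E m' t b) '' C (Sum.inr b))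

/-- Utility of side-`A` agent `a` in the induced one-period economy with outside
option value `W a` (truncated preferences). -/
def indU (P : Pref A B) (W : A → ℝ) (a : A) : Option B → ℝ
  | none => W a
  | some b => P.u a b

/-- Utility of side-`B` agent `b` in the induced one-period economy with outside
option value `W b` (truncated preferences). -/
def indV (P : Pref A B) (W : B → ℝ) (b : B) : Option A → ℝ
  | none => W b
  | some a => P.v a b

/-- The period-`t` component of `mbar` is a stable matching of the one-period economy
`E_{t,φ}(m^{t-1})` induced by the conjecture profile `C` (Definition 6): matching among
the available agents, individually rational w.r.t. the worst-conjecture thresholds,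
and without blocking pairs in the truncated preferences. -/
def StableInduced (P : Pref A B) (E : Economy A B) (m : PreMatching A B) (t : ℕ)
    (C : Agent A B → Set (PreMatching A B)) (mbar : PreMatching A B) : Prop :=
  (∀ a ∈ availA E m t, ∀ b, mbar.mA t a = some b → b ∈ availB E m t ∧ mbar.mB t b = some a) ∧
  (∀ b ∈ availB E m t, ∀ a, mbar.mB t b = some a → a ∈ availA E m t ∧ mbar.mA t a = some b) ∧
  (∀ a ∈ availA E m t, ∀ b, mbar.mA t a = some b → wA P E t C a ≤ P.u a b) ∧
  (∀ b ∈ availB E m t, ∀ a, mbar.mB t b = some a → wB P E t C b ≤ P.v a b) ∧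
  (∀ a ∈ availA E m t, ∀ b ∈ availB E m t,
     ¬(P.u a b > indU P (wA P E t C) a (mbar.mA t a) ∧
       P.v a b > indV P (wB P E t C) b (mbar.mB t b)))

/-- `mbar_t` is stable among those who match in period `t` relative to the conjecture
profile `C` (Definition 7): every available agent matched in period `t` weakly prefers
its partner to its worst conjectured matching, and no pair of agents both matched in
period `t` blocks. -/
def StableAmongMatched (P : Pref A B) (E : Economy A B) (m : PreMatching A B) (t : ℕ)
    (C : Agent A B → Set (PreMatching A B)) (mbar : PreMatching A B) : Prop :=
  (∀ a ∈ availA E m t, ∀ b, mbar.mA t a = some b → wA P E t C a ≤ P.u a b) ∧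
  (∀ b ∈ availB E m t, ∀ a, mbar.mB t b = some a → wB P E t C b ≤ P.v a b) ∧
  (∀ a ∈ availA E m t, ∀ b ∈ availB E m t, ∀ b' a',
     mbar.mA t a = some b' → mbar.mB t b = some a' →
     ¬(P.u a b > P.u a b' ∧ P.v a b > P.v a' b))

/-- `E_t^T(m^{t-1})`: the continuation economy starting at period `t` given history `m`:
its first-period arrivals are the agents available at `t`, later arrivals are unchanged. -/
def contEconomy (E : Economy A B) (m : PreMatching A B) (t : ℕ) : Economy A B where
  T := E.T - t
  arrA := fun s => if s = 0 then availA E m t else E.arrA (t + s)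
  arrB := fun s => if s = 0 then availB E m t else E.arrB (t + s)

/-- The restriction of `m` to the continuation economy starting in period `t`:
time is shifted by `t` and agents matched strictly before `t` are dropped. -/
def restrictM (m : PreMatching A B) (t : ℕ) : PreMatching A B where
  mA := fun s a => if ∀ s', s' < t → m.mA s' a = none then m.mA (t + s) a else none
  mB := fun s b => if ∀ s', s' < t → m.mB s' b = none then m.mB (t + s) b else none

/-- The matching of the original economy corresponding to history `m` through period
`t-1` followed by the continuation matching `m'` (indexed from `0`) of the
continuation economy. -/
def splice (m m' : PreMatching A B) (t : ℕ) : PreMatching A B where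
  mA := fun s a => if s < t then m.mA s a
    else if ∀ s', s' < t → m.mA s' a = none then m'.mA (s - t) a
    else m.mA (t - 1) a
  mB := fun s b => if s < t then m.mB s b
    else if ∀ s', s' < t → m.mB s' b = none then m'.mB (s - t) b
    else m.mB (t - 1) b

/-- The family of conjectures that the family `φ` of the original economy induces on the
continuation economy `E_t^T(m^{t-1})`: at a continuation history, it is the (restriction
of the) original conjectures at the corresponding original history. -/
def contConj (E : Economy A B) (φ : ConjFam A B) (m : PreMatching A B) (t : ℕ) :
    ConjFam A B :=
  fun s mbar k => (fun m' => restrictM m' t) '' φ (t + s) (splice m mbar t) k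

/-- The conjectures of eq. (2): the agent only rules out continuation matchings that do
not conform with the solution concept `S` from tomorrow onward. -/
def starConj (S : Economy A B → Set (PreMatching A B)) (E : Economy A B) : ConjFam A B :=
  fun t m k =>
    {m' | m' ∈ MSet E m t k ∧ restrictM m' (t+1) ∈ S (contEconomy E m' (t+1))}

/-- `S` is the solution correspondence `Σ*` recursively generated by the conjectures of
eq. (2): stability for one-period economies, `Φ*`-solutions for longer economies
(empty continuations impose no restriction). -/
def IsStarFamily (P : Pref A B) (S : Economy A B → Set (PreMatching A B)) : Prop :=
  (∀ E : Economy A B, E.T = 0 → S E = Set.univ) ∧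
  (∀ E : Economy A B, E.T = 1 → S E = {m | Stable1 P E m}) ∧
  (∀ E : Economy A B, 2 ≤ E.T → S E = SolSet P E (starConj S E))

/-- The decreasing recursion defining the CVR conjectures at period `t`, history `m`,
relative to the continuation solution correspondence `DS`. -/
def cvrIter (P : Pref A B) (E : Economy A B)
    (DS : Economy A B → Set (PreMatching A B)) (t : ℕ) (m : PreMatching A B) :
    ℕ → Agent A B → Set (PreMatching A B)
  | 0 => fun k => MSet E m t k
  | n+1 => fun k =>
      {mbar | mbar ∈ MSet E m t k ∧
        StableAmongMatched P E m t (cvrIter P E DS t m n) mbar ∧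
        restrictM mbar (t+1) ∈ DS (contEconomy E mbar (t+1))}

/-- The CVR conjectures `φ_{D̂S,t}(m^{t-1},·)`: the limit (intersection) of the
decreasing recursion `cvrIter`. -/
def cvrConj (P : Pref A B) (DS : Economy A B → Set (PreMatching A B))
    (E : Economy A B) : ConjFam A B :=
  fun t m k => ⋂ n, cvrIter P E DS t m n k

/-- `DS` is the CVR-dynamic-stability correspondence `D̂S`: stable matchings for
one-period economies, `Φ_{D̂S}`-solutions for longer economies. -/
def IsCVRFamily (P : Pref A B) (DS : Economy A B → Set (PreMatching A B)) : Prop :=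
  (∀ E : Economy A B, E.T = 0 → DS E = Set.univ) ∧
  (∀ E : Economy A B, E.T = 1 → DS E = {m | Stable1 P E m}) ∧
  (∀ E : Economy A B, 2 ≤ E.T → DS E = SolSet P E (cvrConj P DS E))

/-- The dynamic-stability conjectures of Doval (2022): the period-`t` matching is stable
among those who match relative to individually rational continuation values, and the
continuation is dynamically stable. -/
def dsConj (P : Pref A B) (DSol : Economy A B → Set (PreMatching A B))
    (E : Economy A B) : ConjFam A B :=
  fun t m k =>
    {mbar | mbar ∈ MSet E m t k ∧
      (∀ a ∈ availA E m t, ∀ b, mbar.mA t a = some b → 0 ≤ P.u a b) ∧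
      (∀ b ∈ availB E m t, ∀ a, mbar.mB t b = some a → 0 ≤ P.v a b) ∧
      (∀ a ∈ availA E m t, ∀ b ∈ availB E m t, ∀ b' a',
         mbar.mA t a = some b' → mbar.mB t b = some a' →
         ¬(P.u a b > P.u a b' ∧ P.v a b > P.v a' b)) ∧
      restrictM mbar (t+1) ∈ DSol (contEconomy E mbar (t+1))}

/-- `DSol` is the dynamic-stability correspondence `DS` of Doval (2022). -/
def IsDSFamily (P : Pref A B) (DSol : Economy A B → Set (PreMatching A B)) : Prop :=
  (∀ E : Economy A B, E.T = 0 → DSol E = Set.univ) ∧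
  (∀ E : Economy A B, E.T = 1 → DSol E = {m | Stable1 P E m}) ∧
  (∀ E : Economy A B, 2 ≤ E.T → DSol E = SolSet P E (dsConj P DSol E))

/-- `E_{\k}`: the economy identical to `E` except that agent `k`'s arrival is delayed
by one period (from period `0` to period `1`). -/
def delayEconomy (E : Economy A B) : Agent A B → Economy A B
  | Sum.inl a =>
      { T := E.T
        arrA := fun s => if s = 0 then E.arrA 0 \ {a}
                 else if s = 1 then insert a (E.arrA 1) else E.arrA s
        arrB := E.arrB }
  | Sum.inr b =>
      { T := E.T
        arrA := E.arrA
        arrB := fun s => if s = 0 then E.arrB 0 \ {b}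
                 else if s = 1 then insert b (E.arrB 1) else E.arrB s }

/-- The candidate set `M*(m^{t-1}, C, Scont)`: matchings whose period-`t` matching is
stable in the one-period economy induced by the continuation-value sets `C`, and whose
continuation lies in `Scont` of the induced continuation economy. -/
def candT (P : Pref A B) (Scont : Economy A B → Set (PreMatching A B))
    (E : Economy A B) (t : ℕ) (m : PreMatching A B)
    (C : Agent A B → Set (PreMatching A B)) : Set (PreMatching A B) :=
  {mbar | mbar ∈ MSetH E m t ∧ StableInduced P E m t C mbar ∧
    restrictM mbar (t+1) ∈ Scont (contEconomy E mbar (t+1))}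

/-- The increasing recursion `F_n` defining the sophisticated-dynamic-stability
conjectures at period `t`, history `m`, relative to the correspondence `SDS` on
strictly shorter problems. -/
def sdsF (P : Pref A B) (SDS : Economy A B → Set (PreMatching A B))
    (E : Economy A B) (t : ℕ) (m : PreMatching A B) :
    ℕ → Agent A B → Set (PreMatching A B)
  | 0 => fun k =>
      {mbar | mbar ∈ MSet E m t k ∧
        restrictM mbar t ∈ SDS (delayEconomy (contEconomy E m t) k)}
  | n+1 => fun k => sdsF P SDS E t m n k ∪
      {mbar | mbar ∈ candT P SDS E t m (sdsF P SDS E t m n) ∧ unmatchedAt mbar t k}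

/-- The SDS conjectures `φ_{SDS,t}`: the limit (union) of the increasing recursion `F_n`. -/
def sdsConj (P : Pref A B) (SDS : Economy A B → Set (PreMatching A B))
    (E : Economy A B) : ConjFam A B :=
  fun t m k => ⋃ n, sdsF P SDS E t m n k

/-- `SDS` is the sophisticated-dynamic-stability correspondence. -/
def IsSDSFamily (P : Pref A B) (SDS : Economy A B → Set (PreMatching A B)) : Prop :=
  (∀ E : Economy A B, E.T = 0 → SDS E = Set.univ) ∧
  (∀ E : Economy A B, E.T = 1 → SDS E = {m | Stable1 P E m}) ∧
  (∀ E : Economy A B, 2 ≤ E.T → SDS E = SolSet P E (sdsConj P SDS E))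

/-- The rational-expectations conjectures: `k` conjectures exactly the `RE` solutions of
the continuation economy in which `k`'s arrival is delayed by one period. -/
def reConj (RE : Economy A B → Set (PreMatching A B)) (E : Economy A B) : ConjFam A B :=
  fun t m k =>
    {mbar | mbar ∈ MSet E m t k ∧
      restrictM mbar t ∈ RE (delayEconomy (contEconomy E m t) k)}

/-- `RE` is the rational-expectations solution correspondence. -/
def IsREFamily (P : Pref A B) (RE : Economy A B → Set (PreMatching A B)) : Prop :=
  (∀ E : Economy A B, E.T = 1 → RE E = {m | Stable1 P E m}) ∧
  (∀ E : Economy A B, 2 ≤ E.T → RE E = SolSet P E (reConj RE E))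


/-- The continuation economy from period `1` of a valid economy of length at least two is
valid. -/
theorem contEconomy_one_valid {E : Economy A B} (hE : E.Valid) (hT : 2 ≤ E.T)
    (m : PreMatching A B) : (contEconomy E m 1).Valid := by
  obtain ⟨-, hA, hB, hA0, hB0⟩ := hE
  have keyA : ∀ s, s ≠ 0 → Disjoint (availA E m 1) (E.arrA (1 + s)) := by
    intro s hs
    refine Finset.disjoint_of_subset_left (Finset.filter_subset _ _) ?_
    refine (Finset.disjoint_biUnion_left _ _ _).2 fun i hi => hA _ _ ?_
    have := Finset.mem_range.1 hi
    omega
  have keyB : ∀ s, s ≠ 0 → Disjoint (availB E m 1) (E.arrB (1 + s)) := by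
    intro s hs
    refine Finset.disjoint_of_subset_left (Finset.filter_subset _ _) ?_
    refine (Finset.disjoint_biUnion_left _ _ _).2 fun i hi => hB _ _ ?_
    have := Finset.mem_range.1 hi
    omega
  refine ⟨?_, ?_, ?_, ?_, ?_⟩
  · change 0 < E.T - 1
    omega
  · intro s t hst
    by_cases hs : s = 0 <;> by_cases ht : t = 0
    · omega
    · simpa [contEconomy, hs, ht] using keyA t ht
    · simpa [contEconomy, hs, ht] using (keyA s hs).symm
    · simpa [contEconomy, hs, ht] using hA (1 + s) (1 + t) (by omega)
  · intro s t hst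
    by_cases hs : s = 0 <;> by_cases ht : t = 0
    · omega
    · simpa [contEconomy, hs, ht] using keyB t ht
    · simpa [contEconomy, hs, ht] using (keyB s hs).symm
    · simpa [contEconomy, hs, ht] using hB (1 + s) (1 + t) (by omega)
  · intro s hs
    have hs' : E.T - 1 ≤ s := hs
    have : s ≠ 0 := by omega
    simpa [contEconomy, this] using hA0 (1 + s) (by omega)
  · intro s hs
    have hs' : E.T - 1 ≤ s := hs
    have : s ≠ 0 := by omega
    simpa [contEconomy, this] using hB0 (1 + s) (by omega)

/-- Side-`A` agents present in the continuation economy have arrived in the original one. -/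
theorem arrAUpTo_contEconomy_one_subset (E : Economy A B) (m : PreMatching A B) (t : ℕ) :
    arrAUpTo (contEconomy E m 1) t ⊆ arrAUpTo E (t + 1) := by
  intro a ha
  obtain ⟨i, hi, hai⟩ := Finset.mem_biUnion.1 ha
  have hi := Finset.mem_range.1 hi
  by_cases h0 : i = 0
  · have h : a ∈ availA E m 1 := by simpa [contEconomy, h0] using hai
    obtain ⟨j, hj, haj⟩ := Finset.mem_biUnion.1 (Finset.mem_filter.1 h).1
    have hj := Finset.mem_range.1 hj
    exact Finset.mem_biUnion.2 ⟨j, Finset.mem_range.2 (by omega), haj⟩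
  · have h : a ∈ E.arrA (1 + i) := by simpa [contEconomy, h0] using hai
    exact Finset.mem_biUnion.2 ⟨1 + i, Finset.mem_range.2 (by omega), h⟩

/-- Side-`B` agents present in the continuation economy have arrived in the original one. -/
theorem arrBUpTo_contEconomy_one_subset (E : Economy A B) (m : PreMatching A B) (t : ℕ) :
    arrBUpTo (contEconomy E m 1) t ⊆ arrBUpTo E (t + 1) := by
  intro b hb
  obtain ⟨i, hi, hbi⟩ := Finset.mem_biUnion.1 hb
  have hi := Finset.mem_range.1 hi
  by_cases h0 : i = 0
  · have h : b ∈ availB E m 1 := by simpa [contEconomy, h0] using hbi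
    obtain ⟨j, hj, hbj⟩ := Finset.mem_biUnion.1 (Finset.mem_filter.1 h).1
    have hj := Finset.mem_range.1 hj
    exact Finset.mem_biUnion.2 ⟨j, Finset.mem_range.2 (by omega), hbj⟩
  · have h : b ∈ E.arrB (1 + i) := by simpa [contEconomy, h0] using hbi
    exact Finset.mem_biUnion.2 ⟨1 + i, Finset.mem_range.2 (by omega), h⟩

/-- Leaving everybody unmatched in the first period and then following `m'`. -/
def waitThen (m' : PreMatching A B) : PreMatching A B where
  mA := fun s a => match s with
    | 0 => none
    | s + 1 => m'.mA s a
  mB := fun s b => match s with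
    | 0 => none
    | s + 1 => m'.mB s b

/-- Restricting to the second period undoes waiting. -/
theorem restrictM_waitThen {α β : Type} (m' : PreMatching α β) :
    restrictM (waitThen m') 1 = m' := by
  simp [restrictM, waitThen, Nat.add_comm 1]

/-- Waiting one period and then following a matching of the continuation economy is a
matching of the original economy. -/
theorem IsMatching.waitThen {E : Economy A B} {m m' : PreMatching A B}
    (h : IsMatching (contEconomy E m 1) m') : IsMatching E (waitThen m') := by
  obtain ⟨h1, h2, h3, h4, h5⟩ := h
  have hT : ∀ {t}, t + 1 < E.T → t < (contEconomy E m 1).T := by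
    intro t ht
    change t < E.T - 1
    omega
  refine ⟨?_, ?_, ?_, ?_, ?_⟩
  · rintro (_ | t) a b ht
    · simp [DynMatch.waitThen]
    · exact h1 t a b (hT ht)
  · rintro (_ | t) a ht hm
    · exact absurd rfl hm
    · exact arrAUpTo_contEconomy_one_subset E m t (h2 t a (hT ht) hm)
  · rintro (_ | t) a b ht hm
    · simp [DynMatch.waitThen] at hm
    · exact arrBUpTo_contEconomy_one_subset E m t (h3 t a b (hT ht) hm)
  · rintro (_ | t) (_ | s) a hts hs hm
    · rfl
    · exact absurd rfl hm
    · omega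
    · exact h4 t s a (by omega) (hT hs) hm
  · rintro (_ | t) (_ | s) b hts hs hm
    · rfl
    · exact absurd rfl hm
    · omega
    · exact h5 t s b (by omega) (hT hs) hm

/-- Members of a CVR-dynamic-stability correspondence are matchings. -/
theorem IsCVRFamily.isMatching {P : Pref A B} {DS : Economy A B → Set (PreMatching A B)}
    (hDS : IsCVRFamily P DS) {E : Economy A B} (hT : 0 < E.T) {m : PreMatching A B}
    (hm : m ∈ DS E) : IsMatching E m := by
  obtain ⟨-, h1, h2⟩ := hDS
  rcases Nat.lt_or_ge E.T 2 with h | h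
  · rw [h1 E (by omega)] at hm
    exact hm.1
  · rw [h2 E h] at hm
    exact hm.1

/-- Payoffs of a side-`A` agent are bounded below over the matchings of an economy. -/
theorem bddBelow_Upay {P : Pref A B} (hP : P.Valid) {E : Economy A B} (hT : 0 < E.T) (t : ℕ)
    (a : A) : BddBelow ((fun m => Upay P E m t a) '' {m | IsMatching E m}) := by
  refine ⟨-∑ b ∈ arrBUpTo E (E.T - 1), |P.u a b|, ?_⟩
  rintro _ ⟨m, hm, rfl⟩
  have hnn : 0 ≤ ∑ b ∈ arrBUpTo E (E.T - 1), |P.u a b| :=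
    Finset.sum_nonneg fun _ _ => abs_nonneg _
  rcases h : m.mA (E.T - 1) a with _ | b
  · simpa [Upay, h] using hnn
  · have hb := hm.2.2.1 (E.T - 1) a b (by omega) h
    have hle : |P.u a b| ≤ ∑ b ∈ arrBUpTo E (E.T - 1), |P.u a b| :=
      Finset.single_le_sum (f := fun b => |P.u a b|) (fun _ _ => abs_nonneg _) hb
    have hd0 := pow_nonneg (hP.1 a).1 (matchTimeA E m t a - t)
    have hd1 := pow_le_one₀ (n := matchTimeA E m t a - t) (hP.1 a).1 (hP.1 a).2
    simp only [Upay, h]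
    nlinarith [neg_abs_le (P.u a b), abs_nonneg (P.u a b)]

/-- Payoffs of a side-`B` agent are bounded below over the matchings of an economy. -/
theorem bddBelow_Vpay {P : Pref A B} (hP : P.Valid) {E : Economy A B} (hT : 0 < E.T) (t : ℕ)
    (b : B) : BddBelow ((fun m => Vpay P E m t b) '' {m | IsMatching E m}) := by
  refine ⟨-∑ a ∈ arrAUpTo E (E.T - 1), |P.v a b|, ?_⟩
  rintro _ ⟨m, hm, rfl⟩
  have hnn : 0 ≤ ∑ a ∈ arrAUpTo E (E.T - 1), |P.v a b| :=
    Finset.sum_nonneg fun _ _ => abs_nonneg _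
  rcases h : m.mB (E.T - 1) b with _ | a
  · simpa [Vpay, h] using hnn
  · have ha : a ∈ arrAUpTo E (E.T - 1) :=
      hm.2.1 (E.T - 1) a (by omega) (by simp [(hm.1 (E.T - 1) a b (by omega)).2 h])
    have hle : |P.v a b| ≤ ∑ a ∈ arrAUpTo E (E.T - 1), |P.v a b| :=
      Finset.single_le_sum (f := fun a => |P.v a b|) (fun _ _ => abs_nonneg _) ha
    have hd0 := pow_nonneg (hP.2 b).1 (matchTimeB E m t b - t)
    have hd1 := pow_le_one₀ (n := matchTimeB E m t b - t) (hP.2 b).1 (hP.2 b).2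
    simp only [Vpay, h]
    nlinarith [neg_abs_le (P.v a b), abs_nonneg (P.v a b)]

/-- If the worst conjectured payoffs go up, stability among those who match becomes harder. -/
theorem StableAmongMatched.mono {P : Pref A B} {E : Economy A B} {m mbar : PreMatching A B}
    {t : ℕ} {C C' : Agent A B → Set (PreMatching A B)} (hA : ∀ a, wA P E t C a ≤ wA P E t C' a)
    (hB : ∀ b, wB P E t C b ≤ wB P E t C' b) (h : StableAmongMatched P E m t C' mbar) :
    StableAmongMatched P E m t C mbar :=
  ⟨fun a ha b hb => (hA a).trans (h.1 a ha b hb), fun b hb a ha => (hB b).trans (h.2.1 b hb a ha),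
    h.2.2⟩

theorem cvrIter_subset_MSet (P : Pref A B) (E : Economy A B)
    (DS : Economy A B → Set (PreMatching A B)) (t : ℕ) (m : PreMatching A B) (n : ℕ)
    (k : Agent A B) : cvrIter P E DS t m n k ⊆ MSet E m t k := by
  cases n with
  | zero => exact subset_rfl
  | succ n => exact fun _ h => h.1

/-- Waiting one period and then following a stable continuation is always conjectured. -/
theorem waitThen_mem_cvrIter {P : Pref A B} {E : Economy A B}
    {DS : Economy A B → Set (PreMatching A B)} {m' : PreMatching A B}
    (hm : IsMatching E (waitThen m')) (hm' : m' ∈ DS (contEconomy E (waitThen m') 1)) (n : ℕ)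
    (k : Agent A B) : waitThen m' ∈ cvrIter P E DS 0 emptyM n k := by
  have hM : waitThen m' ∈ MSet E emptyM 0 k := by
    refine ⟨hm, fun s hs => absurd hs (Nat.not_lt_zero s), ?_⟩
    rcases k with a | b
    · intro s hs
      obtain rfl := Nat.le_zero.1 hs
      rfl
    · intro s hs
      obtain rfl := Nat.le_zero.1 hs
      rfl
  cases n with
  | zero => exact hM
  | succ n =>
    refine ⟨hM, ?_, ?_⟩
    · simp [StableAmongMatched, waitThen]
    · rwa [Nat.zero_add, restrictM_waitThen]

/-- The economy reached by leaving everybody unmatched in the first period does not depend on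
later matches. -/
theorem contEconomy_waitThen (E : Economy A B) (m' : PreMatching A B) :
    contEconomy E (waitThen m') 1 = contEconomy E emptyM 1 := by
  have hA : availA E (waitThen m') 1 = availA E emptyM 1 := by
    simp [availA, waitThen, emptyM]
  have hB : availB E (waitThen m') 1 = availB E emptyM 1 := by
    simp [availB, waitThen, emptyM]
  simp only [contEconomy, hA, hB]

/-- the recursion defining the period-1 CVR conjectures is decreasing:
`φ_{n+1}(∅,k) ⊆ φ_n(∅,k)` for every `n` and every period-1 agent `k`. -/
theorem statement6
    (A B : Type) [DecidableEq A] [DecidableEq B]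
    (P : Pref A B) (hP : P.Valid)
    (DS : Economy A B → Set (PreMatching A B)) (hDS : IsCVRFamily P DS)
    (E : Economy A B) (hE : E.Valid) (hT : 2 ≤ E.T)
    (hne : ∀ E' : Economy A B, E'.Valid → E'.T + 1 = E.T → (DS E').Nonempty) :
    ∀ n : ℕ, ∀ k : Agent A B, inPeriodOne E k →
      cvrIter P E DS 0 emptyM (n+1) k ⊆ cvrIter P E DS 0 emptyM n k := by
  have hval := contEconomy_one_valid hE hT (emptyM : PreMatching A B)
  obtain ⟨m', hm'⟩ := hne _ hval (by change E.T - 1 + 1 = E.T; omega)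
  have hmem := waitThen_mem_cvrIter (P := P) (hDS.isMatching hval.1 hm').waitThen
    ((contEconomy_waitThen E m').symm ▸ hm')
  intro n
  suffices h : ∀ k, cvrIter P E DS 0 emptyM (n + 1) k ⊆ cvrIter P E DS 0 emptyM n k from
    fun k _ => h k
  induction n with
  | zero => exact fun k => cvrIter_subset_MSet P E DS 0 emptyM 1 k
  | succ n ih =>
    rintro k mbar ⟨hM, hS, hc⟩
    refine ⟨hM, hS.mono (fun a => ?_) (fun b => ?_), hc⟩
    · exact csInf_le_csInf
        ((bddBelow_Upay hP (by omega) 0 a).mono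
          (Set.image_mono fun _ h => (cvrIter_subset_MSet _ _ _ _ _ _ _ h).1))
        (Set.Nonempty.image _ ⟨_, hmem _ _⟩) (Set.image_mono (ih _))
    · exact csInf_le_csInf
        ((bddBelow_Vpay hP (by omega) 0 b).mono
          (Set.image_mono fun _ h => (cvrIter_subset_MSet _ _ _ _ _ _ _ h).1))
        (Set.Nonempty.image _ ⟨_, hmem _ _⟩) (Set.image_mono (ih _))

end

end DynMatch
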